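/- Let q > 1000 be a prime power, K > q²/2, t ≤ 10, and let C ⊆ F_q^K be the dual code of a [K, K−t, 2δ]_q code (so |C| = q^t). Let β ≥ (40·q^{t+2}·ln q)/K be a positive integer. For a random Max K-CSP(C) instance Φ with m = βn constraints on n variables, with probability 1 − o(1) as n → ∞, every subgraph of G'_Φ induced by at most 2m left vertices and at most 2m right vertices contains at most 17·β·m·K/q edges; consequently, every subgraph of G'_Φ on 2m vertices contains at most 17·β·m·K/q edges. -/

import Mathlib

open Classical in
/-- The probability of an event `E` in a finite sample space under the uniform
distribution. -/
noncomputable def prUnif {Ω : Type*} [Fintype Ω] (E : Set Ω) : ℝ :=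
  (E.ncard : ℝ) / (Fintype.card Ω : ℝ)

/-- Adjacency in the graph `G'_Φ` built from a Max K-CSP(C) instance `ω`: left
vertices are pairs `(Cᵢ, α)` with `α` a satisfying assignment for `Cᵢ`, right vertices
are `β` copies of the pairs `(x_j, a)`, and `(Cᵢ, α)` is joined to a copy of
`(x_j, a)` iff `x_j` occurs in `Cᵢ`'s tuple and `α(x_j) = a`. (Pairs `(Cᵢ, α)` with
`α` not satisfying `Cᵢ` are not vertices of `G'_Φ`; here they are isolated.)
Only ordered left–right pairs are related, so each edge is counted once. -/
def gPhiAdj (n K M β : ℕ) (F : Type) [Field F]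
    (Ccode : Set (Fin K → F))
    (ω : Fin M → ({T : Fin K → Fin n // Function.Injective T} × (Fin K → F)))
    (u w : (Fin M × (Fin K → F)) ⊕ (Fin n × F × Fin β)) : Prop :=
  match u, w with
  | Sum.inl p, Sum.inr r =>
      ((fun j => p.2 j + (ω p.1).2 j) ∈ Ccode) ∧
      ∃ j : Fin K, (ω p.1).1.1 j = r.1 ∧ p.2 j = r.2.1
  | _, _ => False

/-- The `k` largest values of a function on a finite type are attained on some `k`-element set. -/
lemma exists_card_eq_forall_notMem_le {α : Type*} [Fintype α] (f : α → ℝ) (k : ℕ)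
    (hk : k ≤ Fintype.card α) :
    ∃ S : Finset α, S.card = k ∧ ∀ x ∈ S, ∀ y ∉ S, f y ≤ f x := by
  classical
  induction k with
  | zero => exact ⟨∅, by simp⟩
  | succ k ih =>
    obtain ⟨S, hS, hf⟩ := ih (by omega)
    have hne : Sᶜ.Nonempty := by
      rw [← Finset.card_pos, Finset.card_compl]
      omega
    obtain ⟨z, hz, hmax⟩ := Finset.exists_max_image Sᶜ f hne
    rw [Finset.mem_compl] at hz
    refine ⟨insert z S, by rw [Finset.card_insert_of_notMem hz, hS], fun x hx y hy => ?_⟩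
    rw [Finset.mem_insert, not_or] at hy
    rcases Finset.mem_insert.1 hx with rfl | hx
    · exact hmax y (by simpa using hy.2)
    · exact hf x hx y hy.2

/-- A nonnegative function summed over a collection of at most `β * k` points, each taken at most
`β` times, is at most `β` times its sum over some set of at most `k` points. -/
lemma exists_card_le_sum_le_mul_sum {α ρ : Type*} [Fintype α] [DecidableEq α] (f : α → ℝ)
    (hf : ∀ x, 0 ≤ f x) (β k : ℕ) (R : Finset ρ) (π : ρ → α)
    (hfib : ∀ x, (R.filter fun r => π r = x).card ≤ β) (hR : R.card ≤ β * k) :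
    ∃ S : Finset α, S.card ≤ k ∧ ∑ r ∈ R, f (π r) ≤ β * ∑ x ∈ S, f x := by
  set w : α → ℝ := fun x => ((R.filter fun r => π r = x).card : ℝ) with hw
  have hwβ : ∀ x, w x ≤ β := fun x => Nat.cast_le.2 (hfib x)
  have hw0 : ∀ x, 0 ≤ w x := fun x => by positivity
  have hsum : ∑ r ∈ R, f (π r) = ∑ x, w x * f x := by
    rw [← Finset.sum_fiberwise R π]
    refine Finset.sum_congr rfl fun x _ => ?_
    rw [Finset.sum_congr rfl (g := fun _ => f x) (by simp +contextual)]
    simp [hw]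
  have hwsum : ∑ x, w x = R.card := by
    have := Finset.sum_fiberwise R π (fun _ => (1 : ℝ))
    simpa [hw] using this
  rw [hsum]
  by_cases hk : k ≤ Fintype.card α
  · obtain ⟨S, hS, htop⟩ := exists_card_eq_forall_notMem_le f k hk
    refine ⟨S, hS.le, ?_⟩
    obtain ⟨τ, hτ0, hin, hout⟩ : ∃ τ : ℝ, 0 ≤ τ ∧ (∀ x ∈ S, τ ≤ f x) ∧
        ∀ y ∉ S, w y * f y ≤ w y * τ := by
      rcases S.eq_empty_or_nonempty with rfl | hne
      · refine ⟨0, le_rfl, by simp, fun y _ => ?_⟩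
        have hR0 : R = ∅ := by
          rw [← Finset.card_eq_zero]
          simp at hS
          simpa [← hS] using hR
        simp [hw, hR0]
      · obtain ⟨z, hz, hmin⟩ := Finset.exists_min_image S f hne
        exact ⟨f z, hf z, hmin, fun y hy => mul_le_mul_of_nonneg_left (htop z hz y hy) (hw0 y)⟩
    have hpt : ∀ x, w x * f x ≤ w x * τ + if x ∈ S then β * (f x - τ) else 0 := by
      intro x
      split_ifs with hx
      · nlinarith [mul_le_mul_of_nonneg_right (hwβ x) (sub_nonneg.2 (hin x hx))]
      · simpa using hout x hx
    calc ∑ x, w x * f x ≤ ∑ x, (w x * τ + if x ∈ S then β * (f x - τ) else 0) :=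
          Finset.sum_le_sum fun x _ => hpt x
      _ = R.card * τ + (β * ∑ x ∈ S, f x - β * (k * τ)) := by
          rw [Finset.sum_add_distrib, ← Finset.sum_mul, hwsum, Finset.sum_ite_mem,
            Finset.univ_inter, ← Finset.mul_sum, Finset.sum_sub_distrib, Finset.sum_const, hS,
            nsmul_eq_mul, mul_sub]
      _ ≤ β * ∑ x ∈ S, f x := by
          have : (R.card : ℝ) ≤ β * k := by exact_mod_cast hR
          nlinarith [mul_le_mul_of_nonneg_right this hτ0]
  · refine ⟨Finset.univ, by rw [Finset.card_univ]; omega, ?_⟩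
    rw [Finset.mul_sum]
    exact Finset.sum_le_sum fun x _ => mul_le_mul_of_nonneg_right (hwβ x) (hf x)

/-- Markov's inequality for products over independent uniform samples. -/
lemma card_filter_mul_pow_le {Ω : Type*} [Fintype Ω] [DecidableEq Ω] (B : Finset Ω) (M r : ℕ)
    {x : ℝ} (hx : 1 ≤ x) :
    ((Finset.univ.filter fun ω : Fin M → Ω =>
        r ≤ (Finset.univ.filter fun i => ω i ∈ B).card).card : ℝ) * x ^ r ≤
      (Fintype.card Ω + x * B.card) ^ M := by
  have hx0 : 0 ≤ x := by linarith
  have hone : ∑ y : Ω, (if y ∈ B then x else 1) ≤ Fintype.card Ω + x * B.card := by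
    have : ∀ y : Ω, (if y ∈ B then x else 1) ≤ 1 + if y ∈ B then x else 0 := by
      intro y; split_ifs <;> linarith
    refine (Finset.sum_le_sum fun y _ => this y).trans ?_
    rw [Finset.sum_add_distrib, Finset.sum_ite_mem]
    simp [mul_comm]
  calc _ ≤ ∑ ω : Fin M → Ω, x ^ (Finset.univ.filter fun i => ω i ∈ B).card := by
        rw [← nsmul_eq_mul, ← Finset.sum_const, Finset.sum_filter]
        refine Finset.sum_le_sum fun ω _ => ?_
        split_ifs with h
        · exact pow_le_pow_right₀ hx h
        · positivity
    _ = (∑ y : Ω, (if y ∈ B then x else 1)) ^ M := by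
        rw [Fintype.sum_pow]
        refine Finset.sum_congr rfl fun ω _ => ?_
        rw [Finset.prod_ite, Finset.prod_const, Finset.prod_const_one, mul_one]
    _ ≤ _ := by
        refine pow_le_pow_left₀ (Finset.sum_nonneg fun y _ => ?_) hone M
        split_ifs <;> linarith

open Classical in
/-- The number of coordinates at which the partial assignment `(T, α)` hits `S`. -/
noncomputable def hitCount {V F : Type*} {K : ℕ} (S : Finset (V × F))
    (T : Fin K → V) (α : Fin K → F) : ℕ :=
  (Finset.univ.filter fun j => (T j, α j) ∈ S).card

/-- Exponential moment of `hitCount` for a uniformly shifted word. -/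
lemma sum_two_pow_hitCount_le {V F : Type*} [Fintype V] [Field F] [Fintype F] {K : ℕ}
    [Fintype {T : Fin K → V // Function.Injective T}] (S : Finset (V × F)) (c : Fin K → F) :
    ∑ y : {T : Fin K → V // Function.Injective T} × (Fin K → F),
        (2 : ℝ) ^ hitCount S y.1.1 (c - y.2) ≤
      (Fintype.card V * Fintype.card F + S.card) ^ K := by
  classical
  have hinj : Function.Injective
      (fun (y : {T : Fin K → V // Function.Injective T} × (Fin K → F)) (j : Fin K) =>
        (y.1.1 j, c j - y.2 j)) := by
    intro y z h
    have h1 : ∀ j, y.1.1 j = z.1.1 j := fun j => congrArg Prod.fst (congrFun h j)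
    have h2 : ∀ j, y.2 j = z.2 j := fun j => by simpa using congrArg Prod.snd (congrFun h j)
    exact Prod.ext (Subtype.ext (funext h1)) (funext h2)
  set g : (Fin K → V × F) → ℝ := fun z => ∏ j, (if z j ∈ S then (2 : ℝ) else 1) with hg
  calc _ = ∑ y : {T : Fin K → V // Function.Injective T} × (Fin K → F),
        g fun j => (y.1.1 j, c j - y.2 j) := by
        refine Finset.sum_congr rfl fun y _ => ?_
        simp only [hg]
        rw [Finset.prod_ite, Finset.prod_const, Finset.prod_const_one, mul_one, hitCount]
        congr!
    _ ≤ ∑ z : Fin K → V × F, g z := by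
        rw [← Finset.sum_image (f := g) hinj.injOn]
        refine Finset.sum_le_univ_sum_of_nonneg fun z => Finset.prod_nonneg fun j _ => ?_
        split_ifs <;> norm_num
    _ = (∑ p : V × F, (if p ∈ S then (2 : ℝ) else 1)) ^ K := by rw [Fintype.sum_pow]
    _ = _ := by
        congr 1
        have : ∀ p : V × F, (if p ∈ S then (2 : ℝ) else 1) = 1 + if p ∈ S then 1 else 0 := by
          intro p; split_ifs <;> norm_num
        rw [Finset.sum_congr rfl fun p _ => this p, Finset.sum_add_distrib, Finset.sum_ite_mem]
        simp

/-- An exponential-weight bound for the number of sets of size at most `k`. -/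
lemma card_filter_card_le_le {α : Type*} [Fintype α] (k : ℕ) {q : ℝ} (hq : 1 ≤ q) :
    ((Finset.univ.filter fun S : Finset α => S.card ≤ k).card : ℝ) ≤
      q ^ k * Real.exp (Fintype.card α / q) := by
  have hq0 : 0 < q := by linarith
  calc ((Finset.univ.filter fun S : Finset α => S.card ≤ k).card : ℝ)
      ≤ ∑ S : Finset α, q ^ k * (q⁻¹) ^ S.card := by
        rw [Finset.card_filter, Nat.cast_sum]
        refine Finset.sum_le_sum fun S _ => ?_
        split_ifs with h
        · rw [inv_pow, ← div_eq_mul_inv, Nat.cast_one, one_le_div (by positivity)]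
          exact pow_le_pow_right₀ hq h
        · simp only [Nat.cast_zero]; positivity
    _ = q ^ k * (q⁻¹ + 1) ^ Fintype.card α := by
        rw [← Finset.mul_sum, ← Fintype.sum_pow_mul_eq_add_pow]
        simp
    _ ≤ q ^ k * Real.exp (Fintype.card α / q) := by
        rw [div_eq_mul_inv, Real.exp_nat_mul]
        have := Real.add_one_le_exp q⁻¹
        gcongr

/-- The orthogonal complement of a code of dimension `d` has `q ^ (K - d)` words. -/
lemma ncard_dual_code {F : Type*} [Field F] [Fintype F] {K : ℕ}
    (C : Submodule F (Fin K → F)) :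
    {c : Fin K → F | ∀ d ∈ C, ∑ j : Fin K, c j * d j = 0}.ncard =
      Fintype.card F ^ (K - Module.finrank F C) := by
  classical
  have hset : {c : Fin K → F | ∀ d ∈ C, ∑ j : Fin K, c j * d j = 0} =
      ((C.dualAnnihilator.comap (dotProductEquiv F (Fin K)).toLinearMap :
        Submodule F (Fin K → F)) : Set (Fin K → F)) := by
    ext c
    simp [Submodule.mem_dualAnnihilator, dotProduct]
  have hfin : Module.finrank F
      (C.dualAnnihilator.comap (dotProductEquiv F (Fin K)).toLinearMap) =
      K - Module.finrank F C := by
    have h1 := Subspace.finrank_add_finrank_dualAnnihilator_eq C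
    rw [Module.finrank_fin_fun] at h1
    have h2 : Module.finrank F
      (C.dualAnnihilator.comap (dotProductEquiv F (Fin K)).toLinearMap) =
        Module.finrank F C.dualAnnihilator :=
      (Submodule.comap_equiv_eq_map_symm (dotProductEquiv F (Fin K)) C.dualAnnihilator) ▸
        LinearEquiv.finrank_map_eq (dotProductEquiv F (Fin K)).symm C.dualAnnihilator
    omega
  rw [hset, ← hfin, ← Nat.card_coe_set_eq, ← Nat.card_eq_fintype_card]
  exact Module.natCard_eq_pow_finrank

lemma eventually_pow_le_two_mul_descFactorial (K : ℕ) :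
    ∀ᶠ n : ℕ in Filter.atTop, (n : ℝ) ^ K ≤ 2 * n.descFactorial K := by
  filter_upwards [(isEquivalent_descFactorial K).symm.isLittleO.bound
    (show (0 : ℝ) < 1 by norm_num)] with n hn
  simp only [Pi.sub_apply, Real.norm_eq_abs, one_mul, Nat.abs_cast] at hn
  linarith [le_abs_self ((n : ℝ) ^ K - n.descFactorial K)]

open Classical in
/-- The samples `(T, b)` of a single constraint for which some satisfying assignment hits `S` in
more than `θ` coordinates. -/
noncomputable def heavySamples {V F : Type*} [Fintype V] [Field F] [Fintype F] {K : ℕ}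
    [Fintype {T : Fin K → V // Function.Injective T}]
    (C : Set (Fin K → F)) (θ : ℝ) (S : Finset (V × F)) :
    Finset ({T : Fin K → V // Function.Injective T} × (Fin K → F)) :=
  Finset.univ.filter fun y => ∃ c ∈ C, θ < hitCount S y.1.1 (c - y.2)

/-- Markov's inequality for `heavySamples`, with a union bound over the code. -/
lemma card_heavySamples_mul_le {V F : Type*} [Fintype V] [Field F] [Fintype F] {K : ℕ}
    [Fintype {T : Fin K → V // Function.Injective T}]
    (C : Set (Fin K → F)) (θ x : ℝ) (hx : ∀ d : ℕ, θ < d → x ≤ (2 : ℝ) ^ d)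
    (S : Finset (V × F)) :
    ((heavySamples C θ S).card : ℝ) * x ≤
      C.ncard * (Fintype.card V * Fintype.card F + S.card : ℝ) ^ K := by
  classical
  have hle : ∀ y ∈ heavySamples C θ S,
      x ≤ ∑ c ∈ C.toFinset, (2 : ℝ) ^ hitCount S y.1.1 (c - y.2) := by
    intro y hy
    obtain ⟨c, hc, hlt⟩ := (Finset.mem_filter.1 hy).2
    calc x ≤ (2 : ℝ) ^ hitCount S y.1.1 (c - y.2) := hx _ hlt
      _ ≤ _ := Finset.single_le_sum (f := fun c => (2 : ℝ) ^ hitCount S y.1.1 (c - y.2))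
          (fun c _ => by positivity) (Set.mem_toFinset.2 hc)
  calc ((heavySamples C θ S).card : ℝ) * x = ∑ y ∈ heavySamples C θ S, x := by simp
    _ ≤ ∑ y ∈ heavySamples C θ S,
          ∑ c ∈ C.toFinset, (2 : ℝ) ^ hitCount S y.1.1 (c - y.2) := Finset.sum_le_sum hle
    _ ≤ ∑ y : {T : Fin K → V // Function.Injective T} × (Fin K → F),
          ∑ c ∈ C.toFinset, (2 : ℝ) ^ hitCount S y.1.1 (c - y.2) :=
        Finset.sum_le_univ_sum_of_nonneg fun y => Finset.sum_nonneg fun c _ => by positivity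
    _ = ∑ c ∈ C.toFinset, ∑ y : {T : Fin K → V // Function.Injective T} × (Fin K → F),
          (2 : ℝ) ^ hitCount S y.1.1 (c - y.2) := Finset.sum_comm
    _ ≤ ∑ c ∈ C.toFinset, (Fintype.card V * Fintype.card F + S.card : ℝ) ^ K :=
        Finset.sum_le_sum fun c _ => sum_two_pow_hitCount_le S c
    _ = _ := by rw [Finset.sum_const, nsmul_eq_mul, Set.ncard_eq_toFinset_card']

lemma card_heavySamples_le {F : Type*} [Field F] [Fintype F] {K n q : ℕ}
    [Fintype {T : Fin K → Fin n // Function.Injective T}]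
    (hF : Fintype.card F = q) (hq : 0 < q) (C : Set (Fin K → F)) (S : Finset (Fin n × F))
    (hS : S.card ≤ 2 * n) (hn : (n : ℝ) ^ K ≤ 2 * n.descFactorial K) :
    ((heavySamples C (8 * (K / q)) S).card : ℝ) ≤
      2 * C.ncard * Real.exp (-3 * (K / q)) *
        Fintype.card ({T : Fin K → Fin n // Function.Injective T} × (Fin K → F)) := by
  classical
  have hq0 : (0 : ℝ) < q := by exact_mod_cast hq
  set k : ℝ := K / q with hk
  have hk0 : 0 ≤ k := by positivity
  have hcard : (Fintype.card ({T : Fin K → Fin n // Function.Injective T} × (Fin K → F)) : ℝ) =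
      n.descFactorial K * (q : ℝ) ^ K := by
    rw [Fintype.card_prod, Fintype.card_congr (Equiv.subtypeInjectiveEquivEmbedding _ _),
      Fintype.card_embedding_eq, Fintype.card_fun, hF]
    simp
  have hpow : ∀ d : ℕ, 8 * k < d → Real.exp (5 * k) ≤ (2 : ℝ) ^ d := by
    intro d hd
    rw [← Real.exp_log (show (0 : ℝ) < 2 ^ d by positivity), Real.log_pow, Real.exp_le_exp]
    nlinarith [Real.log_two_gt_d9]
  rw [hcard]
  generalize (n.descFactorial K : ℝ) = D at hn
  have hmain : ((heavySamples C (8 * k) S).card : ℝ) * Real.exp (5 * k) ≤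
      C.ncard * (2 * (D * (q : ℝ) ^ K) * Real.exp (2 * k)) := by
    refine (card_heavySamples_mul_le C (8 * k) _ hpow S).trans ?_
    rw [Fintype.card_fin, hF]
    have hexp : Real.exp (2 * k) = Real.exp (2 / q) ^ K := by
      rw [← Real.exp_nat_mul, hk]; congr 1; ring
    have h2 : (S.card : ℝ) ≤ 2 * n := by exact_mod_cast hS
    have h3 : (n : ℝ) * q + S.card ≤ n * q * Real.exp (2 / q) :=
      calc (n : ℝ) * q + S.card ≤ n * q * (2 / q + 1) := by field_simp; linarith
        _ ≤ _ := by gcongr; exact Real.add_one_le_exp _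
    refine mul_le_mul_of_nonneg_left ?_ (Nat.cast_nonneg _)
    calc ((n : ℝ) * q + S.card) ^ K ≤ (n * q * Real.exp (2 / q)) ^ K := by gcongr
      _ = (n : ℝ) ^ K * ((q : ℝ) ^ K * Real.exp (2 * k)) := by
          rw [hexp, mul_pow, mul_pow]; ring
      _ ≤ 2 * D * ((q : ℝ) ^ K * Real.exp (2 * k)) := by gcongr
      _ = _ := by ring
  have h5 : Real.exp (2 * k) = Real.exp (-3 * k) * Real.exp (5 * k) := by
    rw [← Real.exp_add]; congr 1; ring
  refine le_of_mul_le_mul_right (hmain.trans_eq ?_) (Real.exp_pos (5 * k))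
  rw [h5]; ring

/-- For a fixed `S`, few instances have at least `r` constraints that are heavy for `S`. -/
lemma card_filter_le_heavySamples_le {F : Type*} [Field F] [Fintype F] {K n q : ℕ}
    [Fintype {T : Fin K → Fin n // Function.Injective T}]
    (hF : Fintype.card F = q) (hq : 0 < q) (C : Set (Fin K → F)) (S : Finset (Fin n × F))
    (hS : S.card ≤ 2 * n) (hn : (n : ℝ) ^ K ≤ 2 * n.descFactorial K) (M r : ℕ) :
    ({ω : Fin M → {T : Fin K → Fin n // Function.Injective T} × (Fin K → F) |
        r ≤ {i | ω i ∈ heavySamples C (8 * (K / q)) S}.ncard}.ncard : ℝ) ≤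
      Real.exp (M * (2 * C.ncard * Real.exp (-(K / q : ℝ))) - r * (2 * (K / q))) *
        Fintype.card (Fin M → {T : Fin K → Fin n // Function.Injective T} × (Fin K → F)) := by
  classical
  have hq0 : (0 : ℝ) < q := by exact_mod_cast hq
  have hB := card_heavySamples_le hF hq C S hS hn
  set B := heavySamples C (8 * (K / q : ℝ)) S with hBdef
  set k : ℝ := K / q with hk
  have hk0 : 0 ≤ k := by positivity
  set N := Fintype.card ({T : Fin K → Fin n // Function.Injective T} × (Fin K → F)) with hN
  have hx := card_filter_mul_pow_le B M r (Real.one_le_exp (x := 2 * k) (by positivity))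
  have hset : ({ω : Fin M → {T : Fin K → Fin n // Function.Injective T} × (Fin K → F) |
        r ≤ {i | ω i ∈ B}.ncard}.ncard : ℝ) = (Finset.univ.filter fun
      ω : Fin M → {T : Fin K → Fin n // Function.Injective T} × (Fin K → F) =>
        r ≤ (Finset.univ.filter fun i => ω i ∈ B).card).card := by
    simp [Set.ncard_eq_toFinset_card']
  rw [hset]
  have h1 : (N + Real.exp (2 * k) * B.card : ℝ) ≤
      N * Real.exp (2 * C.ncard * Real.exp (-k)) := by
    have h2 : Real.exp (-k) = Real.exp (2 * k) * Real.exp (-3 * k) := by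
      rw [← Real.exp_add]; congr 1; ring
    calc (N + Real.exp (2 * k) * B.card : ℝ)
        ≤ N + Real.exp (2 * k) * (2 * C.ncard * Real.exp (-3 * k) * N) := by gcongr
      _ = N * (2 * C.ncard * Real.exp (-k) + 1) := by rw [h2]; ring
      _ ≤ _ := by gcongr; exact Real.add_one_le_exp _
  rw [Real.exp_sub, Real.exp_nat_mul, Real.exp_nat_mul, div_mul_eq_mul_div,
    le_div_iff₀ (by positivity)]
  refine hx.trans ((pow_le_pow_left₀ (by positivity) h1 M).trans_eq ?_)
  rw [mul_pow, Fintype.card_fun, Fintype.card_fin, Nat.cast_pow, mul_comm]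

/-- A code of size `q ^ t` with `t ≤ 10` is negligible against `exp (K / q)`. -/
lemma two_mul_pow_mul_exp_neg_le {q t : ℕ} {k : ℝ} (hq : 1000 < q) (ht : t ≤ 10)
    (hk : (q : ℝ) / 2 < k) :
    2 * (q : ℝ) ^ t * Real.exp (-k) ≤ k / (q : ℝ) ^ (t + 1) := by
  have hq1 : (1000 : ℝ) < q := by exact_mod_cast hq
  have hlog : Real.log q ≤ 6 + q / 1000 := by
    have h1 : Real.log (q / 1000) ≤ q / 1000 - 1 := Real.log_le_sub_one_of_pos (by positivity)
    rw [Real.log_div (by positivity) (by norm_num)] at h1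
    have h2 : Real.log 1000 ≤ Real.log (2 ^ 10) := Real.log_le_log (by norm_num) (by norm_num)
    rw [Real.log_pow] at h2
    push_cast at h2
    linarith [Real.log_two_lt_d9]
  have hpow : (q : ℝ) ^ (t + (t + 1)) ≤ Real.exp k := by
    calc (q : ℝ) ^ (t + (t + 1)) ≤ (q : ℝ) ^ 21 := pow_le_pow_right₀ (by linarith) (by omega)
      _ = Real.exp (21 * Real.log q) := by
          rw [mul_comm, Real.exp_mul, Real.exp_log (by positivity)]; norm_cast
      _ ≤ Real.exp k := Real.exp_le_exp.2 (by linarith)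
  rw [le_div_iff₀ (by positivity), Real.exp_neg]
  calc 2 * (q : ℝ) ^ t * (Real.exp k)⁻¹ * (q : ℝ) ^ (t + 1)
      = 2 * ((q : ℝ) ^ (t + (t + 1)) * (Real.exp k)⁻¹) := by rw [pow_add (q : ℝ) t]; ring
    _ ≤ 2 * 1 := by
        gcongr
        rw [← div_eq_mul_inv]
        exact div_le_one_of_le₀ hpow (Real.exp_pos k).le
    _ ≤ k := by linarith

open Classical in
/-- The number of variable-value pairs in `S` that agree with `(T, α)` is at most the hit count. -/
lemma sum_ite_exists_le_hitCount {V F : Type*} {K : ℕ} (S : Finset (V × F)) (T : Fin K → V)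
    (α : Fin K → F) :
    ∑ x ∈ S, (if ∃ j, T j = x.1 ∧ α j = x.2 then (1 : ℝ) else 0) ≤ hitCount S T α := by
  rw [Finset.sum_boole, hitCount, Nat.cast_le]
  refine (Finset.card_le_card fun x hx => ?_).trans
    (Finset.card_image_le (s := Finset.univ.filter fun j => (T j, α j) ∈ S)
      (f := fun j => (T j, α j)))
  obtain ⟨hxS, j, h1, h2⟩ := Finset.mem_filter.1 hx
  have hj : (T j, α j) = x := Prod.ext h1 h2
  exact Finset.mem_image.2 ⟨j, Finset.mem_filter.2 ⟨Finset.mem_univ _, hj ▸ hxS⟩, hj⟩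

open Classical in
lemma hitCount_le {V F : Type*} {K : ℕ} (S : Finset (V × F)) (T : Fin K → V)
    (α : Fin K → F) : hitCount S T α ≤ K := by
  simpa [hitCount] using Finset.card_le_univ (Finset.univ.filter fun j => (T j, α j) ∈ S)

open Classical in
/-- If no small `S` is heavy for more than `h` constraints, then the graph of the instance has
few edges between small sets. -/
lemma sum_gPhiAdj_le {F : Type} [Field F] [Fintype F] {K n M β k : ℕ}
    [Fintype {T : Fin K → Fin n // Function.Injective T}] (C : Set (Fin K → F)) {θ h : ℝ}
    (hθ : 0 ≤ θ) (ω : Fin M → {T : Fin K → Fin n // Function.Injective T} × (Fin K → F))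
    (hω : ∀ S : Finset (Fin n × F), S.card ≤ k →
      ({i | ω i ∈ heavySamples C θ S}.ncard : ℝ) ≤ h)
    (L : Finset (Fin M × (Fin K → F))) (hL : ∀ p ∈ L, (fun j => p.2 j + (ω p.1).2 j) ∈ C)
    (R : Finset (Fin n × F × Fin β)) (hR : R.card ≤ β * k) :
    ∑ p ∈ L, ∑ r ∈ R, (if gPhiAdj n K M β F C ω (Sum.inl p) (Sum.inr r) then (1 : ℝ) else 0) ≤
      β * (L.card * θ + K * (C.ncard * h)) := by
  set f : Fin n × F → ℝ := fun x =>
    ∑ p ∈ L, if ∃ j, (ω p.1).1.1 j = x.1 ∧ p.2 j = x.2 then 1 else 0 with hf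
  have hedge : ∑ p ∈ L, ∑ r ∈ R,
      (if gPhiAdj n K M β F C ω (Sum.inl p) (Sum.inr r) then (1 : ℝ) else 0) ≤
        ∑ r ∈ R, f (r.1, r.2.1) := by
    rw [Finset.sum_comm]
    refine Finset.sum_le_sum fun r _ => Finset.sum_le_sum fun p _ => ?_
    by_cases hadj : gPhiAdj n K M β F C ω (Sum.inl p) (Sum.inr r)
    · rw [if_pos hadj, if_pos hadj.2]
    · rw [if_neg hadj]
      split_ifs <;> norm_num
  have hfib : ∀ x, (R.filter fun r => (r.1, r.2.1) = x).card ≤ β := by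
    intro x
    calc _ ≤ (Finset.univ : Finset (Fin β)).card := by
          refine Finset.card_le_card_of_injOn (fun r => r.2.2) (fun _ _ => Finset.mem_univ _) ?_
          intro r hr s hs hrs
          have h1 := (Finset.mem_filter.1 hr).2.trans (Finset.mem_filter.1 hs).2.symm
          rw [Prod.mk.injEq] at h1
          exact Prod.ext h1.1 (Prod.ext h1.2 hrs)
      _ = β := by simp
  obtain ⟨S, hS, hSle⟩ := exists_card_le_sum_le_mul_sum f
    (fun x => Finset.sum_nonneg fun p _ => by split_ifs <;> norm_num) β k R
    (fun r => (r.1, r.2.1)) hfib hR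
  refine hedge.trans (hSle.trans (mul_le_mul_of_nonneg_left ?_ (Nat.cast_nonneg β)))
  have hpt : ∀ p ∈ L, (hitCount S (ω p.1).1.1 p.2 : ℝ) ≤
      θ + if ω p.1 ∈ heavySamples C θ S then (K : ℝ) else 0 := by
    intro p hp
    split_ifs with hheavy
    · have : (hitCount S (ω p.1).1.1 p.2 : ℝ) ≤ K := Nat.cast_le.2 (hitCount_le _ _ _)
      linarith
    · rw [add_zero]
      by_contra! hlt
      refine hheavy (Finset.mem_filter.2 ⟨Finset.mem_univ _, _, hL p hp, ?_⟩)
      have hshift : (fun j => p.2 j + (ω p.1).2 j) - (ω p.1).2 = p.2 := by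
        ext j
        simp
      rwa [hshift]
  have hcount : ((L.filter fun p => ω p.1 ∈ heavySamples C θ S).card : ℝ) ≤ C.ncard * h := by
    have hprod : (L.filter fun p => ω p.1 ∈ heavySamples C θ S).card ≤
        ({i | ω i ∈ heavySamples C θ S}.toFinset ×ˢ C.toFinset).card := by
      refine Finset.card_le_card_of_injOn (fun p => (p.1, p.2 + (ω p.1).2)) ?_ ?_
      · intro p hp
        obtain ⟨hpL, hph⟩ := Finset.mem_filter.1 hp
        exact Finset.mem_product.2 ⟨Set.mem_toFinset.2 hph, Set.mem_toFinset.2 (hL p hpL)⟩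
      · rintro ⟨i, a⟩ - ⟨j, b⟩ - hab
        rw [Prod.mk.injEq] at hab
        obtain ⟨rfl, h2⟩ := hab
        simpa using h2
    rw [Finset.card_product, ← Set.ncard_eq_toFinset_card', ← Set.ncard_eq_toFinset_card',
      mul_comm] at hprod
    calc _ ≤ ((C.ncard * {i | ω i ∈ heavySamples C θ S}.ncard : ℕ) : ℝ) := by
          exact_mod_cast hprod
      _ ≤ _ := by
          rw [Nat.cast_mul]
          exact mul_le_mul_of_nonneg_left (hω S hS) (Nat.cast_nonneg _)
  calc ∑ x ∈ S, f x = ∑ p ∈ L, ∑ x ∈ S,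
        (if ∃ j, (ω p.1).1.1 j = x.1 ∧ p.2 j = x.2 then (1 : ℝ) else 0) := Finset.sum_comm
    _ ≤ ∑ p ∈ L, (θ + if ω p.1 ∈ heavySamples C θ S then (K : ℝ) else 0) :=
        Finset.sum_le_sum fun p hp => le_trans
          (le_of_eq_of_le (by congr!) (sum_ite_exists_le_hitCount S (ω p.1).1.1 p.2)) (hpt p hp)
    _ = L.card * θ + K * (L.filter fun p => ω p.1 ∈ heavySamples C θ S).card := by
        rw [Finset.sum_add_distrib, ← Finset.sum_filter]
        simp [mul_comm]
    _ ≤ _ := by gcongr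

open Classical in
/-- Bounding the edges between the two sides bounds the edges in every induced subgraph. -/
lemma sum_gPhiAdj_le_of_bipartite {F : Type} [Field F] {K n M β N : ℕ} (C : Set (Fin K → F))
    (ω : Fin M → {T : Fin K → Fin n // Function.Injective T} × (Fin K → F)) {B : ℝ}
    (h : ∀ L : Finset (Fin M × (Fin K → F)),
      (∀ p ∈ L, (fun j => p.2 j + (ω p.1).2 j) ∈ C) → L.card ≤ N →
      ∀ R : Finset (Fin n × F × Fin β), R.card ≤ N →
        ∑ p ∈ L, ∑ r ∈ R,
          (if gPhiAdj n K M β F C ω (Sum.inl p) (Sum.inr r) then (1 : ℝ) else 0) ≤ B)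
    (W : Finset ((Fin M × (Fin K → F)) ⊕ (Fin n × F × Fin β))) (hW : W.card ≤ N) :
    ∑ u ∈ W, ∑ w ∈ W, (if gPhiAdj n K M β F C ω u w then (1 : ℝ) else 0) ≤ B := by
  refine le_trans (le_of_eq ?_) (h (W.toLeft.filter fun p => (fun j => p.2 j + (ω p.1).2 j) ∈ C)
    (fun p hp => (Finset.mem_filter.1 hp).2)
    ((Finset.card_filter_le _ _).trans (Finset.card_toLeft_le.trans hW))
    W.toRight (Finset.card_toRight_le.trans hW))
  simp only [Finset.sum_sum_eq_sum_toLeft_add_sum_toRight]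
  have hll : ∀ p p', ¬ gPhiAdj n K M β F C ω (Sum.inl p) (Sum.inl p') := fun _ _ hadj => hadj
  have hr : ∀ r u, ¬ gPhiAdj n K M β F C ω (Sum.inr r) u := fun _ _ hadj => hadj
  simp only [hll, hr, if_false, Finset.sum_const_zero, zero_add, add_zero]
  rw [Finset.sum_filter]
  refine Finset.sum_congr rfl fun p _ => ?_
  split_ifs with hp
  · rfl
  · exact Finset.sum_eq_zero fun r _ => if_neg fun hadj => hp hadj.1

lemma one_sub_le_prUnif_of_compl_subset {Ω : Type*} [Fintype Ω] [Nonempty Ω] {E B : Set Ω} {ε : ℝ}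
    (hEB : Eᶜ ⊆ B) (hB : (B.ncard : ℝ) ≤ ε * Fintype.card Ω) : 1 - ε ≤ prUnif E := by
  have hpos : (0 : ℝ) < Fintype.card Ω := by exact_mod_cast Fintype.card_pos
  rw [prUnif, le_div_iff₀ hpos]
  have h1 : (E.ncard : ℝ) + Eᶜ.ncard = Fintype.card Ω := by
    rw [← Nat.card_eq_fintype_card]; exact_mod_cast Set.ncard_add_ncard_compl E
  have h2 : (Eᶜ.ncard : ℝ) ≤ B.ncard := by exact_mod_cast Set.ncard_le_ncard hEB
  linarith

lemma prUnif_le_one {Ω : Type*} [Fintype Ω] (E : Set Ω) : prUnif E ≤ 1 := by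
  refine div_le_one_of_le₀ ?_ (Nat.cast_nonneg _)
  rw [← Nat.card_eq_fintype_card]
  exact_mod_cast Set.ncard_le_card E

/-- Union bound over the small sets `S`. -/
lemma ncard_exists_heavySamples_le {F : Type} [Field F] [Fintype F] {K n q t β : ℕ}
    [Fintype {T : Fin K → Fin n // Function.Injective T}]
    (hq : 1000 < q) (hF : Fintype.card F = q) (hKq : (q : ℝ) ^ 2 / 2 < K) (ht : t ≤ 10)
    (C : Set (Fin K → F)) (hC : C.ncard = q ^ t)
    (hβ : 40 * (q : ℝ) ^ (t + 2) * Real.log q / K ≤ β)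
    (hn : (n : ℝ) ^ K ≤ 2 * n.descFactorial K) :
    ({ω : Fin (β * n) → {T : Fin K → Fin n // Function.Injective T} × (Fin K → F) |
        ∃ S : Finset (Fin n × F), S.card ≤ 2 * n ∧ ((β * n : ℕ) : ℝ) / (q : ℝ) ^ (t + 1) <
          {i | ω i ∈ heavySamples C (8 * (K / q)) S}.ncard}.ncard : ℝ) ≤
      Real.exp (-n) * Fintype.card
        (Fin (β * n) → {T : Fin K → Fin n // Function.Injective T} × (Fin K → F)) := by
  classical
  have hq1 : (1000 : ℝ) < q := by exact_mod_cast hq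
  have hK0 : (0 : ℝ) < K := lt_trans (by positivity) hKq
  have hk : (q : ℝ) / 2 < K / q := by
    rw [lt_div_iff₀ (by positivity)]; nlinarith
  have hneg := two_mul_pow_mul_exp_neg_le hq ht hk
  set m : ℕ := β * n with hm
  set r : ℕ := ⌈(m : ℝ) / (q : ℝ) ^ (t + 1)⌉₊ with hr
  set Ω := Fin m → {T : Fin K → Fin n // Function.Injective T} × (Fin K → F)
  set A : Finset (Fin n × F) → Set Ω := fun S =>
    {ω | r ≤ {i | ω i ∈ heavySamples C (8 * (K / q)) S}.ncard} with hA
  set small : Finset (Finset (Fin n × F)) :=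
    Finset.univ.filter fun S => S.card ≤ 2 * n with hsmall
  have hlog : 1 ≤ Real.log q := by
    rw [Real.le_log_iff_exp_le (by positivity)]
    linarith [Real.exp_one_lt_d9]
  have hmk : 40 * n * Real.log q ≤ m / (q : ℝ) ^ (t + 1) * (K / q) := by
    rw [div_le_iff₀ hK0] at hβ
    rw [div_mul_div_comm, ← pow_succ, le_div_iff₀ (by positivity), hm, Nat.cast_mul]
    nlinarith [mul_le_mul_of_nonneg_left hβ (Nat.cast_nonneg (α := ℝ) n)]
  have hsingle : ∀ S ∈ small, ((A S).ncard : ℝ) ≤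
      Real.exp (-(40 * n * Real.log q)) * Fintype.card Ω := by
    intro S hS
    refine (card_filter_le_heavySamples_le hF (by omega) C S (Finset.mem_filter.1 hS).2 hn m
      r).trans (mul_le_mul_of_nonneg_right (Real.exp_le_exp.2 ?_) (Nat.cast_nonneg _))
    have h1 : (m : ℝ) / (q : ℝ) ^ (t + 1) ≤ r := Nat.le_ceil _
    have h2 := mul_le_mul_of_nonneg_left hneg (Nat.cast_nonneg (α := ℝ) m)
    have h3 : (m : ℝ) * (K / q / (q : ℝ) ^ (t + 1)) = m / (q : ℝ) ^ (t + 1) * (K / q) := by ring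
    have h4 := mul_le_mul_of_nonneg_right h1 (show (0 : ℝ) ≤ 2 * (K / q) by positivity)
    rw [hC, Nat.cast_pow]
    linarith
  have hcard : (small.card : ℝ) ≤ Real.exp (2 * n * Real.log q + n) := by
    refine (card_filter_card_le_le (2 * n) (q := q) (by linarith)).trans_eq ?_
    rw [Real.exp_add, Fintype.card_prod, Fintype.card_fin, hF, Nat.cast_mul,
      mul_div_cancel_right₀ _ (by positivity)]
    congr 1
    have := Real.exp_nat_mul (Real.log q) (2 * n)
    rw [Real.exp_log (by positivity)] at this
    push_cast at this
    exact this.symm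
  calc _ ≤ ((⋃ S ∈ small, A S).ncard : ℝ) := by
        refine Nat.cast_le.2 (Set.ncard_le_ncard ?_)
        rintro ω ⟨S, hS, hlt⟩
        exact Set.mem_biUnion (x := S) (by simpa [hsmall] using hS) (Nat.ceil_le.2 hlt.le)
    _ ≤ ∑ S ∈ small, ((A S).ncard : ℝ) := by
        exact_mod_cast Finset.set_ncard_biUnion_le small A
    _ ≤ small.card * (Real.exp (-(40 * n * Real.log q)) * Fintype.card Ω) := by
        rw [← nsmul_eq_mul]; exact Finset.sum_le_card_nsmul _ _ _ hsingle
    _ ≤ Real.exp (2 * n * Real.log q + n) *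
          (Real.exp (-(40 * n * Real.log q)) * Fintype.card Ω) := by gcongr
    _ ≤ Real.exp (-n) * Fintype.card Ω := by
        rw [← mul_assoc, ← Real.exp_add]
        refine mul_le_mul_of_nonneg_right (Real.exp_le_exp.2 ?_) (Nat.cast_nonneg _)
        nlinarith [mul_le_mul_of_nonneg_left hlog (Nat.cast_nonneg (α := ℝ) n)]

open Classical in
/-- Let `q > 1000` be a prime power (realized as a finite field `F`
with `|F| = q`), `K > q²/2`, `t ≤ 10`, `C` the dual of a `[K, K−t, 2δ]_q` code, and
`β ≥ (40 q^{t+2} ln q)/K` a positive integer. For a random Max K-CSP(C) instance with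
`m = βn` constraints, with probability `1 − o(1)`: every subgraph of `G'_Φ` induced by
at most `2m` left and at most `2m` right vertices has at most `17 β m K / q` edges, and
consequently every subgraph of `G'_Φ` on `2m` vertices has at most `17 β m K / q`
edges. -/
theorem csp_graph_soundness_replicated_whp (q : ℕ) (hq : 1000 < q)
    (F : Type) [Field F] [Fintype F] [DecidableEq F] (hF : Fintype.card F = q)
    (K t δ : ℕ) (hKq : (q : ℝ) ^ 2 / 2 < (K : ℝ)) (ht : t ≤ 10)
    (Ccode : Set (Fin K → F))
    (hdual : ∃ C' : Submodule F (Fin K → F),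
      Module.finrank F C' = K - t ∧
      (∀ c ∈ C', c ≠ 0 → 2 * δ ≤ hammingNorm c) ∧
      Ccode = {c : Fin K → F | ∀ d ∈ C', ∑ j : Fin K, c j * d j = 0})
    (β : ℕ) (hβpos : 0 < β)
    (hβ : (40 * (q : ℝ) ^ (t + 2) * Real.log q) / (K : ℝ) ≤ (β : ℝ)) :
    Filter.Tendsto (fun n : ℕ => prUnif
      {ω : Fin (β * n) → ({T : Fin K → Fin n // Function.Injective T} × (Fin K → F)) |
        (∀ Lset : Finset (Fin (β * n) × (Fin K → F)),
          (∀ p ∈ Lset, (fun j => p.2 j + (ω p.1).2 j) ∈ Ccode) →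
          Lset.card ≤ 2 * (β * n) →
          ∀ Rset : Finset (Fin n × F × Fin β), Rset.card ≤ 2 * (β * n) →
          (∑ p ∈ Lset, ∑ r ∈ Rset,
            if gPhiAdj n K (β * n) β F Ccode ω (Sum.inl p) (Sum.inr r)
            then (1 : ℝ) else 0) ≤
            17 * (β : ℝ) * ((β * n : ℕ) : ℝ) * (K : ℝ) / (q : ℝ)) ∧
        (∀ W : Finset ((Fin (β * n) × (Fin K → F)) ⊕ (Fin n × F × Fin β)),
          W.card = 2 * (β * n) →
          (∑ u ∈ W, ∑ w ∈ W,
            if gPhiAdj n K (β * n) β F Ccode ω u w then (1 : ℝ) else 0) ≤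
            17 * (β : ℝ) * ((β * n : ℕ) : ℝ) * (K : ℝ) / (q : ℝ))})
      Filter.atTop (nhds 1) := by
  obtain ⟨C', hdim, -, hCeq⟩ := hdual
  have hq1 : (1000 : ℝ) < q := by exact_mod_cast hq
  have htK : t ≤ K := by
    have : (t : ℝ) ≤ 10 := by exact_mod_cast ht
    have : (t : ℝ) ≤ K := by nlinarith
    exact_mod_cast this
  have hC : Ccode.ncard = q ^ t := by
    rw [hCeq, ncard_dual_code, hF, hdim, Nat.sub_sub_self htK]
  have hlim : Filter.Tendsto (fun n : ℕ => 1 - Real.exp (-(n : ℝ))) Filter.atTop (nhds 1) := by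
    simpa using (Real.tendsto_exp_neg_atTop_nhds_zero.comp
      tendsto_natCast_atTop_atTop).const_sub (1 : ℝ)
  refine tendsto_of_tendsto_of_tendsto_of_le_of_le' hlim tendsto_const_nhds ?_
    (Filter.Eventually.of_forall fun n => prUnif_le_one _)
  filter_upwards [eventually_pow_le_two_mul_descFactorial K, Filter.eventually_ge_atTop K]
    with n hn hnK
  have : Nonempty {T : Fin K → Fin n // Function.Injective T} :=
    ⟨⟨Fin.castLE hnK, Fin.castLE_injective hnK⟩⟩
  refine one_sub_le_prUnif_of_compl_subset (fun ω hω => ?_)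
    (ncard_exists_heavySamples_le hq hF hKq ht Ccode hC hβ hn)
  by_contra hgood
  refine hω ?_
  simp only [Set.mem_ofPred_eq, not_exists, not_and, not_lt] at hgood
  have hbip : ∀ L : Finset (Fin (β * n) × (Fin K → F)),
      (∀ p ∈ L, (fun j => p.2 j + (ω p.1).2 j) ∈ Ccode) → L.card ≤ 2 * (β * n) →
      ∀ R : Finset (Fin n × F × Fin β), R.card ≤ 2 * (β * n) →
      (∑ p ∈ L, ∑ r ∈ R, if gPhiAdj n K (β * n) β F Ccode ω (Sum.inl p) (Sum.inr r)
        then (1 : ℝ) else 0) ≤ 17 * (β : ℝ) * ((β * n : ℕ) : ℝ) * (K : ℝ) / (q : ℝ) := by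
    intro L hL hLcard R hR
    refine (sum_gPhiAdj_le Ccode (by positivity) ω hgood L hL R (by linarith)).trans ?_
    have hL' : (L.card : ℝ) ≤ 2 * (β * n : ℕ) := by exact_mod_cast hLcard
    rw [hC, Nat.cast_pow]
    calc (β : ℝ) * (L.card * (8 * (K / q)) +
          K * ((q : ℝ) ^ t * ((β * n : ℕ) / (q : ℝ) ^ (t + 1))))
        ≤ β * (2 * (β * n : ℕ) * (8 * (K / q)) +
          K * ((q : ℝ) ^ t * ((β * n : ℕ) / (q : ℝ) ^ (t + 1)))) := by gcongr
      _ = _ := by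
          field_simp
          ring
  exact ⟨hbip, fun W hW => sum_gPhiAdj_le_of_bipartite Ccode ω hbip W hW.le⟩
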